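/- arXiv:2301.01890 — 2 statements merged into one kernel-verified Lean document; each statement's English description precedes it below -/
import Mathlib

section
/- Let A = (Q, δ, I, F) be a BA over Σ and P_1, …, P_n a partitioning of A. Then the union over i = 1, …, n of the languages L(A_{P_i}) equals L(A), where A_{P_i} denotes A with accepting transitions restricted to those between states of P_i. -/
attribute [local instance] Classical.propDecidable

universe u v w y

/-- Emerson–Lei acceptance conditions over colours `γ`. -/
inductive EL (γ : Type u) : Type u
  | inf : γ → EL γ
  | fin : γ → EL γ
  | conj : EL γ → EL γ → EL γ
  | disj : EL γ → EL γ → EL γ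

/-- Satisfaction of an Emerson–Lei condition by a set `M` of colours. -/
def EL.sat {γ : Type u} (M : Set γ) : EL γ → Prop
  | .inf c => c ∈ M
  | .fin c => c ∉ M
  | .conj φ ψ => φ.sat M ∧ ψ.sat M
  | .disj φ ψ => φ.sat M ∨ ψ.sat M

/-- Renaming of colours in an Emerson–Lei condition. -/
def EL.map {γ : Type u} {γ' : Type v} (f : γ → γ') : EL γ → EL γ'
  | .inf c => .inf (f c)
  | .fin c => .fin (f c)
  | .conj φ ψ => .conj (φ.map f) (ψ.map f)
  | .disj φ ψ => .disj (φ.map f) (ψ.map f)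

/-- A (transition-based) Büchi automaton over alphabet `A` with states `Q`. -/
structure BA (Q : Type u) (A : Type v) where
  delta : Set (Q × A × Q)
  init : Set Q
  F : Set (Q × A × Q)
  F_sub : F ⊆ delta

namespace BA

variable {Q : Type u} {A : Type v}

/-- `δ(S, a)`. -/
def deltaSet (M : BA Q A) (S : Set Q) (a : A) : Set Q :=
  {q | ∃ p ∈ S, (p, a, q) ∈ M.delta}

/-- `δ_F(S, a)`. -/
def deltaF (M : BA Q A) (S : Set Q) (a : A) : Set Q :=
  {q | ∃ p ∈ S, (p, a, q) ∈ M.F}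

/-- `δ(S, u)` for a finite word `u`. -/
def deltaWord (M : BA Q A) (S : Set Q) : List A → Set Q
  | [] => S
  | a :: u => M.deltaWord (M.deltaSet S a) u

/-- A run of the BA on an infinite word. -/
def IsRun (M : BA Q A) (w : ℕ → A) (ρ : ℕ → Q) : Prop :=
  ρ 0 ∈ M.init ∧ ∀ i, (ρ i, w i, ρ (i + 1)) ∈ M.delta

/-- An accepting run of the BA on an infinite word. -/
def AccRun (M : BA Q A) (w : ℕ → A) (ρ : ℕ → Q) : Prop :=
  M.IsRun w ρ ∧ {i | (ρ i, w i, ρ (i + 1)) ∈ M.F}.Infinite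

/-- The language of the BA. -/
def lang (M : BA Q A) : Set (ℕ → A) := {w | ∃ ρ, M.AccRun w ρ}

/-- Completeness of a BA. -/
def Complete (M : BA Q A) : Prop :=
  M.init.Nonempty ∧ ∀ q a, ∃ q', (q, a, q') ∈ M.delta

/-- One transition step (over some symbol). -/
def Step (M : BA Q A) (p q : Q) : Prop := ∃ a, (p, a, q) ∈ M.delta

/-- Reachability. -/
def Reach (M : BA Q A) : Q → Q → Prop := Relation.ReflTransGen M.Step

/-- Mutual reachability, i.e., lying in the same SCC. -/
def SameSCC (M : BA Q A) (p q : Q) : Prop := M.Reach p q ∧ M.Reach q p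

/-- A strongly connected component: a maximal nonempty set of pairwise
mutually reachable states. -/
def IsSCC (M : BA Q A) (C : Set Q) : Prop :=
  C.Nonempty ∧ (∀ p ∈ C, ∀ q ∈ C, M.Reach p q) ∧
    ∀ D, C ⊆ D → (∀ p ∈ D, ∀ q ∈ D, M.Reach p q) → D ⊆ C

/-- An accepting SCC: one containing an accepting transition with both
endpoints in it. -/
def IsAccSCC (M : BA Q A) (C : Set Q) : Prop :=
  M.IsSCC C ∧ ∃ p ∈ C, ∃ a, ∃ q ∈ C, (p, a, q) ∈ M.F

/-- `δ_SCC(S, a)`: restriction of `δ` to transitions staying in one SCC. -/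
def deltaSCC (M : BA Q A) (S : Set Q) (a : A) : Set Q :=
  {q | ∃ p ∈ S, (p, a, q) ∈ M.delta ∧ M.SameSCC p q}

/-- A cycle of length `k > 0` lying inside the set `C`. -/
def IsCycleIn (M : BA Q A) (C : Set Q) (k : ℕ) (ρ : ℕ → Q) (σ : ℕ → A) : Prop :=
  0 < k ∧ ρ 0 = ρ k ∧ ∀ i < k, ρ i ∈ C ∧ (ρ i, σ i, ρ (i + 1)) ∈ M.delta

/-- `C` is inherently weak: every cycle inside `C` contains an accepting
transition, or no cycle inside `C` contains one. -/
def InherentlyWeak (M : BA Q A) (C : Set Q) : Prop :=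
  (∀ k ρ σ, M.IsCycleIn C k ρ σ → ∃ i < k, (ρ i, σ i, ρ (i + 1)) ∈ M.F) ∨
  (∀ k ρ σ, M.IsCycleIn C k ρ σ → ∀ i < k, (ρ i, σ i, ρ (i + 1)) ∉ M.F)

/-- `C` is a deterministic SCC. -/
def DetSCC (M : BA Q A) (C : Set Q) : Prop :=
  ∀ q ∈ C, ∀ a : A, (M.deltaSet {q} a ∩ C).Subsingleton

/-- A partition block: a nonempty union of accepting SCCs. -/
def IsPartitionBlock (M : BA Q A) (P : Set Q) : Prop :=
  P.Nonempty ∧ ∃ Cs : Set (Set Q), (∀ C ∈ Cs, M.IsAccSCC C) ∧ P = ⋃₀ Cs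

/-- `A_P`: accepting transitions restricted to those between states of `P`. -/
def restrict (M : BA Q A) (P : Set Q) : BA Q A where
  delta := M.delta
  init := M.init
  F := M.F ∩ {t | t.1 ∈ P ∧ t.2.2 ∈ P}
  F_sub := fun _ ht => M.F_sub ht.1

end BA

/-- A partitioning of a BA: pairwise disjoint partition blocks containing
all accepting SCCs. -/
def IsPartitioning {Q : Type u} {A : Type v} {n : ℕ} (M : BA Q A)
    (P : Fin n → Set Q) : Prop :=
  (∀ i, M.IsPartitionBlock (P i)) ∧
  (Pairwise fun i j => Disjoint (P i) (P j)) ∧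
  ∀ C, M.IsAccSCC C → ∃ i, C ⊆ P i

/-- A transition-based Emerson–Lei automaton; transitions carry sets of
colours. -/
structure TELA (Q : Type u) (A : Type v) (γ : Type w) where
  trans : Set (Q × A × Set γ × Q)
  init : Set Q
  acc : EL γ

namespace TELA

variable {Q : Type u} {A : Type v} {γ : Type w}

/-- A run of the TELA (state sequence together with emitted colour sets). -/
def IsRun (T : TELA Q A γ) (w : ℕ → A) (ρ : ℕ → Q) (κ : ℕ → Set γ) : Prop :=
  ρ 0 ∈ T.init ∧ ∀ i, (ρ i, w i, κ i, ρ (i + 1)) ∈ T.trans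

/-- The union of colour sets of transitions occurring infinitely often. -/
def infCols (w : ℕ → A) (ρ : ℕ → Q) (κ : ℕ → Set γ) : Set γ :=
  {c | ∃ t : Q × A × Set γ × Q,
    {i | (ρ i, w i, κ i, ρ (i + 1)) = t}.Infinite ∧ c ∈ t.2.2.1}

/-- An accepting run of the TELA. -/
def AccRun (T : TELA Q A γ) (w : ℕ → A) (ρ : ℕ → Q) (κ : ℕ → Set γ) : Prop :=
  T.IsRun w ρ κ ∧ EL.sat (infCols w ρ κ) T.acc

/-- The language of the TELA. -/
def lang (T : TELA Q A γ) : Set (ℕ → A) := {w | ∃ ρ κ, T.AccRun w ρ κ}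

end TELA

/-- A partial complementation instance for a partition block. -/
structure PartialAlg (Q : Type u) (A : Type v) (T : Type w) (γ : Type y) where
  init : Set T
  succ : Set Q → T → A → Set (T × Set γ)
  acc : EL γ

/-- `ModCompl` for a single partial complementation instance. -/
def ModCompl1 {Q : Type u} {A : Type v} {T : Type w} {γ : Type y}
    (M : BA Q A) (alg : PartialAlg Q A T γ) : TELA (Set Q × T) A γ where
  init := {x | x.1 = M.init ∧ x.2 ∈ alg.init}
  trans := {x | ∃ H m a m' α, (m', α) ∈ alg.succ H m a ∧
    x = ((H, m), a, α, (M.deltaSet H a, m'))}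
  acc := alg.acc

/-- Conjunction of a nonempty family of Emerson–Lei conditions. -/
def ELbigAnd {γ : Type u} {n : ℕ} (f : Fin (n + 1) → EL γ) : EL γ :=
  List.foldl EL.conj (f 0) (List.ofFn fun i : Fin n => f i.succ)

/-- The synchronous modular complementation `ModCompl` for several partial
complementation instances; colours are renumbered via `Sigma.mk`. -/
def ModComplN {Q : Type u} {A : Type v} {n : ℕ} {T : Fin (n + 1) → Type w}
    {γ : Fin (n + 1) → Type y} (M : BA Q A)
    (alg : ∀ i, PartialAlg Q A (T i) (γ i)) :
    TELA (Set Q × (∀ i, T i)) A (Σ i, γ i) where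
  init := {x | x.1 = M.init ∧ ∀ i, x.2 i ∈ (alg i).init}
  trans := {x | ∃ (H : Set Q) (m : ∀ i, T i) (a : A) (m' : ∀ i, T i)
      (α : ∀ i, Set (γ i)),
    (∀ i, (m' i, α i) ∈ (alg i).succ H (m i) a) ∧
    x = ((H, m), a, {c : Σ i, γ i | c.2 ∈ α c.1}, (M.deltaSet H a, m'))}
  acc := ELbigAnd fun i => ((alg i).acc).map (Sigma.mk i)

/-- A partial round-robin complementation instance. -/
structure RRAlg (Q : Type u) (A : Type v) (Tt Ta : Type w) (γ : Type y) where
  init : Set Tt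
  succT : Set Q → Tt → A → Set (Tt × Set γ)
  succA : Set Q → Ta → A → Set ((Tt ⊕ Ta) × Set γ)
  lift : Tt → Set Ta
  acc : EL γ

/-- The flattening `algunion` of a partial round-robin instance. -/
def RRAlg.flatten {Q : Type u} {A : Type v} {Tt Ta : Type w} {γ : Type y}
    (R : RRAlg Q A Tt Ta γ) : PartialAlg Q A (Tt ⊕ Ta) γ where
  init := Sum.inl '' R.init
  succ := fun H m a =>
    match m with
    | Sum.inr mA => R.succA H mA a
    | Sum.inl mT =>
        {x | ∃ p ∈ R.succT H mT a, x = (Sum.inl p.1, p.2)} ∪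
        {x | ∃ p ∈ R.succT H mT a, ∃ m'' ∈ R.lift p.1, x = (Sum.inr m'', p.2)}
  acc := R.acc

/-- Consistency (conditions (C1)–(C3)) of a partial round-robin instance with
respect to a BA `B`. -/
def RRConsistent {Q : Type u} {A : Type v} {Tt Ta : Type w} {γ : Type y}
    (B : BA Q A) (R : RRAlg Q A Tt Ta γ) : Prop :=
  (∀ w ∈ (ModCompl1 B R.flatten).lang, ∃ ρ κ,
      (ModCompl1 B R.flatten).AccRun w ρ κ ∧
      {j | (ρ j).2.isRight = true ∧ ¬ (ρ (j + 1)).2.isRight = true}.Infinite) ∧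
  (∀ w ρ κ, (ModCompl1 B R.flatten).AccRun w ρ κ → ∀ i : ℕ,
      (i = 0 ∨ (ρ (i - 1)).2.isLeft = true) →
      ((∃ ρ' κ', (ModCompl1 B R.flatten).AccRun w ρ' κ' ∧
          (∀ j < i, ρ' j = ρ j) ∧ (ρ' i).2.isLeft = true) ∧
       (∃ ρ'' κ'', (ModCompl1 B R.flatten).AccRun w ρ'' κ'' ∧
          (∀ j < i, ρ'' j = ρ j) ∧ (ρ'' i).2.isRight = true))) ∧
  (∀ w ρ κ, (ModCompl1 B R.flatten).IsRun w ρ κ →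
      {j | (ρ j).2.isRight = true ∧ ¬ (ρ (j + 1)).2.isRight = true}.Infinite →
      (ModCompl1 B R.flatten).AccRun w ρ κ)

/-- Along a sequence of transitions, later states are reachable from earlier ones. -/
theorem BA.reach_of_le {Q A : Type*} {M : BA Q A} {w : ℕ → A} {ρ : ℕ → Q}
    (h : ∀ i, (ρ i, w i, ρ (i + 1)) ∈ M.delta) {i j : ℕ} (hij : i ≤ j) :
    M.Reach (ρ i) (ρ j) := by
  induction j, hij using Nat.le_induction with
  | base => exact .refl
  | succ k _ ih => exact ih.tail ⟨w k, h k⟩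

/-- The states mutually reachable with `p` form an SCC. -/
theorem BA.isSCC_setOf_sameSCC {Q A : Type*} (M : BA Q A) (p : Q) :
    M.IsSCC {x | M.SameSCC p x} :=
  ⟨⟨p, .refl, .refl⟩, fun _ hx _ hy => hx.2.trans hy.1,
    fun _ hCD hD x hx =>
      have hp := hCD (show M.SameSCC p p from ⟨.refl, .refl⟩)
      ⟨hD p hp x hx, hD x hx p hp⟩⟩

/-- Restricting the accepting transitions shrinks the language. -/
theorem BA.lang_restrict_subset {Q A : Type*} (M : BA Q A) (P : Set Q) :
    (M.restrict P).lang ⊆ M.lang :=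
  fun _ ⟨ρ, hρ, hF⟩ => ⟨ρ, hρ, hF.mono fun _ hi => hi.1⟩

/-- An accepting run takes infinitely often accepting transitions within a single
accepting SCC. -/
theorem BA.AccRun.exists_isAccSCC {Q A : Type*} [Finite Q] {M : BA Q A} {w : ℕ → A}
    {ρ : ℕ → Q} (h : M.AccRun w ρ) :
    ∃ C, M.IsAccSCC C ∧
      {i | (ρ i, w i, ρ (i + 1)) ∈ M.F ∧ ρ i ∈ C ∧ ρ (i + 1) ∈ C}.Infinite := by
  obtain ⟨⟨-, hδ⟩, hF⟩ := h
  obtain ⟨⟨p, q⟩, hpq⟩ : ∃ t : Q × Q,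
      {i | (ρ i, w i, ρ (i + 1)) ∈ M.F ∧ (ρ i, ρ (i + 1)) = t}.Infinite := by
    by_contra! hfin
    refine hF ((Set.finite_iUnion hfin).subset fun i hi => ?_)
    exact Set.mem_iUnion.2 ⟨_, hi, rfl⟩
  obtain ⟨i, hiF, hi⟩ := hpq.nonempty
  obtain ⟨j, ⟨-, hj⟩, hij⟩ := hpq.exists_gt i
  obtain ⟨rfl, rfl⟩ := Prod.mk.inj hi
  have hp : M.SameSCC (ρ i) (ρ i) := ⟨.refl, .refl⟩
  have hq : M.SameSCC (ρ i) (ρ (i + 1)) :=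
    ⟨BA.reach_of_le hδ i.le_succ, (Prod.mk.inj hj).1 ▸ BA.reach_of_le hδ hij⟩
  refine ⟨{x | M.SameSCC (ρ i) x},
    ⟨M.isSCC_setOf_sameSCC _, _, hp, _, _, hq, hiF⟩, hpq.mono ?_⟩
  rintro k ⟨hkF, hk⟩
  obtain ⟨hk₁, hk₂⟩ := Prod.mk.inj hk
  refine ⟨hkF, ?_, ?_⟩
  · rw [hk₁]; exact hp
  · rw [hk₂]; exact hq

theorem statement0 {Q A : Type} [Fintype Q] [Fintype A] [Nonempty A] {n : ℕ}
    (M : BA Q A) (P : Fin n → Set Q) (hP : IsPartitioning M P) :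
    (⋃ i, (M.restrict (P i)).lang) = M.lang := by
  refine (Set.iUnion_subset fun i => M.lang_restrict_subset (P i)).antisymm ?_
  rintro w ⟨ρ, hρ⟩
  obtain ⟨C, hC, hinf⟩ := hρ.exists_isAccSCC
  obtain ⟨i, hi⟩ := hP.2.2 C hC
  exact Set.mem_iUnion.2
    ⟨i, ρ, hρ.1, hinf.mono fun _ hk => ⟨hk.1, hi hk.2.1, hi hk.2.2⟩⟩
end

section
/- Let A = (Q, δ, I, F) be a complete BA and P a partition block of A such that every SCC of A contained in P is accepting and inherently weak and every accepting transition of A has both endpoints in P. Let C be the deterministic TELA with states 2^Q × 2^P × 2^P, single colour 0, acceptance condition Inf 0, initial state (I, I ∩ P, I ∩ P), and, for every state (H, C, B) and a ∈ Σ, the unique transition to (δ(H,a), C', B') where C' = δ(H,a) ∩ P and, setting B* = δ(B,a) ∩ C': B' = C' and the transition carries colour set {0} if B* = ∅, and B' = B* with colour set ∅ otherwise. Then L(C) = Σ^ω \ L(A). -/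
attribute [local instance] Classical.propDecidable

universe u v w y

/-- The breakpoint (Miyano–Hayashi style) complementation TELA for a partition
block `P` consisting of accepting inherently weak SCCs. -/
def iwcTELA {Q A : Type} (M : BA Q A) (P : Set Q) :
    TELA (Set Q × Set Q × Set Q) A Unit where
  init := {(M.init, M.init ∩ P, M.init ∩ P)}
  trans := {x | ∃ (H C B : Set Q) (a : A),
    x = ((H, C, B), a,
      (if M.deltaSet B a ∩ (M.deltaSet H a ∩ P) = ∅ then ({()} : Set Unit) else ∅),
      (M.deltaSet H a, M.deltaSet H a ∩ P,
        if M.deltaSet B a ∩ (M.deltaSet H a ∩ P) = ∅ then M.deltaSet H a ∩ P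
        else M.deltaSet B a ∩ (M.deltaSet H a ∩ P)))}
  acc := .inf ()

namespace BA

variable {Q : Type u} {A : Type v} {M : BA Q A}

theorem SameSCC.symm {p q : Q} (h : M.SameSCC p q) : M.SameSCC q p := ⟨h.2, h.1⟩

theorem SameSCC.trans {p q r : Q} (h : M.SameSCC p q) (h' : M.SameSCC q r) :
    M.SameSCC p r :=
  ⟨Relation.ReflTransGen.trans h.1 h'.1, Relation.ReflTransGen.trans h'.2 h.2⟩

theorem isSCC_setOf_sameSCC_s3 (M : BA Q A) (q : Q) : M.IsSCC {x | M.SameSCC q x} := by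
  have hq : q ∈ {x | M.SameSCC q x} :=
    ⟨Relation.ReflTransGen.refl, Relation.ReflTransGen.refl⟩
  exact ⟨⟨q, hq⟩, fun x hx y hy => (hx.symm.trans hy).1,
    fun D hD hR x hx => ⟨hR q (hD hq) x hx, hR x hx q (hD hq)⟩⟩

theorem IsSCC.mem_of_sameSCC {C : Set Q} (hC : M.IsSCC C) {q x : Q} (hq : q ∈ C)
    (h : M.SameSCC q x) : x ∈ C :=
  hC.2.2 {y | M.SameSCC q y} (fun y hy => ⟨hC.2.1 q hq y hy, hC.2.1 y hy q hq⟩)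
    (M.isSCC_setOf_sameSCC_s3 q).2.1 h

theorem IsPartitionBlock.mem_of_sameSCC {P : Set Q} (hP : M.IsPartitionBlock P) {q x : Q}
    (hq : q ∈ P) (h : M.SameSCC q x) : x ∈ P := by
  obtain ⟨-, Cs, hCs, rfl⟩ := hP
  obtain ⟨C, hC, hqC⟩ := hq
  exact ⟨C, hC, (hCs C hC).1.mem_of_sameSCC hqC h⟩

theorem Reach.exists_path [Nonempty A] {x y : Q} (h : M.Reach x y) :
    ∃ (k : ℕ) (ρ : ℕ → Q) (σ : ℕ → A), ρ 0 = x ∧ ρ k = y ∧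
      ∀ i < k, (ρ i, σ i, ρ (i + 1)) ∈ M.delta := by
  induction h using Relation.ReflTransGen.head_induction_on with
  | refl => exact ⟨0, fun _ => y, fun _ => Classical.arbitrary A, rfl, rfl, by simp⟩
  | @head x z hxz _ ih =>
    obtain ⟨a, ha⟩ := hxz
    obtain ⟨k, ρ, σ, h0, hk, hρ⟩ := ih
    refine ⟨k + 1, fun i => i.casesOn x ρ, fun i => i.casesOn a σ, rfl, hk, ?_⟩
    rintro (_ | i) hi
    · simpa [h0] using ha
    · exact hρ i (by omega)

theorem reach_of_path {ρ : ℕ → Q} {σ : ℕ → A} {i j : ℕ} (hij : i ≤ j)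
    (h : ∀ k, i ≤ k → k < j → (ρ k, σ k, ρ (k + 1)) ∈ M.delta) : M.Reach (ρ i) (ρ j) := by
  induction j, hij using Nat.le_induction with
  | base => exact Relation.ReflTransGen.refl
  | succ j hij ih =>
    exact Relation.ReflTransGen.tail (ih fun k h1 h2 => h k h1 (by omega))
      ⟨σ j, h j hij (by omega)⟩

/-- In an accepting inherently weak SCC every cycle is accepting. -/
theorem IsAccSCC.exists_mem_F_of_isCycleIn [Nonempty A] {C : Set Q} (hC : M.IsAccSCC C)
    (hw : M.InherentlyWeak C) {k : ℕ} {ρ : ℕ → Q} {σ : ℕ → A} (h : M.IsCycleIn C k ρ σ) :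
    ∃ i < k, (ρ i, σ i, ρ (i + 1)) ∈ M.F := by
  rcases hw with hw | hw
  · exact hw k ρ σ h
  obtain ⟨hS, p, hp, a, q, hq, hF⟩ := hC
  obtain ⟨n, τ, υ, h0, hn, hτ⟩ := Reach.exists_path (hS.2.1 q hq p hp)
  refine absurd hF ?_
  have hcyc : M.IsCycleIn C (n + 1) (fun i => i.casesOn p τ) (fun i => i.casesOn a υ) := by
    refine ⟨n.succ_pos, hn.symm, ?_⟩
    rintro (_ | i) hi
    · exact ⟨hp, by simpa [h0] using M.F_sub hF⟩
    · have hi' : i < n := by omega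
      refine ⟨hS.mem_of_sameSCC hq ⟨?_, ?_⟩, hτ i hi'⟩
      · exact h0 ▸ reach_of_path (Nat.zero_le i) fun k _ hk => hτ k (by omega)
      · exact Relation.ReflTransGen.trans
          (hn ▸ reach_of_path hi'.le fun k _ hk => hτ k hk : M.Reach (τ i) p)
          (hS.2.1 p hp q hq)
  simpa [h0] using hw _ _ _ hcyc 0 n.succ_pos

theorem IsRun.reach {w : ℕ → A} {ρ : ℕ → Q} (h : M.IsRun w ρ) {i j : ℕ} (hij : i ≤ j) :
    M.Reach (ρ i) (ρ j) :=
  reach_of_path hij fun k _ _ => h.2 k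

theorem IsRun.sameSCC {w : ℕ → A} {ρ : ℕ → Q} (h : M.IsRun w ρ) {q : Q}
    (hq : {i | ρ i = q}.Infinite) {i j : ℕ} (hi : ρ i = q) (hij : i ≤ j) :
    M.SameSCC q (ρ j) := by
  obtain ⟨k, hk, hjk⟩ := hq.exists_gt j
  exact ⟨hi ▸ h.reach hij, (show ρ k = q from hk) ▸ h.reach hjk.le⟩

theorem exists_infinite_fiber_of_infinite {X : Type*} [Finite X] {s : Set ℕ} (hs : s.Infinite)
    (f : ℕ → X) : ∃ x, {i | i ∈ s ∧ f i = x}.Infinite := by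
  by_contra! h
  refine hs ((Set.finite_iUnion fun x => h x).subset fun i hi => ?_)
  exact Set.mem_iUnion.mpr ⟨f i, hi, rfl⟩

/-- An accepting run is eventually trapped in a block containing all accepting transitions. -/
theorem AccRun.eventually_mem [Finite Q] {P : Set Q} (hP : M.IsPartitionBlock P)
    (hF : ∀ p a q, (p, a, q) ∈ M.F → p ∈ P ∧ q ∈ P) {w : ℕ → A} {ρ : ℕ → Q}
    (h : M.AccRun w ρ) : ∃ n, ∀ i ≥ n, ρ i ∈ P := by
  obtain ⟨q, hq⟩ := exists_infinite_fiber_of_infinite h.2 ρ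
  obtain ⟨n, hnF, hn⟩ := hq.nonempty
  have hqP : q ∈ P := hn ▸ (hF _ _ _ hnF).1
  exact ⟨n, fun i hi =>
    hP.mem_of_sameSCC hqP (h.1.sameSCC (hq.mono fun _ hj => hj.2) hn hi)⟩

/-- A run eventually trapped in a block of inherently weak accepting SCCs is accepting. -/
theorem IsRun.accRun_of_eventually_mem [Finite Q] [Nonempty A] {P : Set Q}
    (hP : M.IsPartitionBlock P)
    (hweak : ∀ C, M.IsSCC C → C ⊆ P → M.IsAccSCC C ∧ M.InherentlyWeak C)
    {w : ℕ → A} {ρ : ℕ → Q} (h : M.IsRun w ρ) {n : ℕ} (hn : ∀ i ≥ n, ρ i ∈ P) :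
    M.AccRun w ρ := by
  obtain ⟨q, hq⟩ := exists_infinite_fiber_of_infinite Set.infinite_univ ρ
  simp only [Set.mem_univ, true_and] at hq
  have hqP : q ∈ P := by
    obtain ⟨i, hi, hni⟩ := hq.exists_gt n
    exact (show ρ i = q from hi) ▸ hn i hni.le
  obtain ⟨hacc, hw⟩ := hweak _ (M.isSCC_setOf_sameSCC_s3 q) fun x hx => hP.mem_of_sameSCC hqP hx
  refine ⟨h, Set.infinite_of_forall_exists_gt fun m => ?_⟩
  obtain ⟨i, hi, hmi⟩ := hq.exists_gt m
  obtain ⟨j, hj, hij⟩ := hq.exists_gt i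
  have hi' : ρ i = q := hi
  have hj' : ρ j = q := hj
  obtain ⟨k, -, hk⟩ := hacc.exists_mem_F_of_isCycleIn hw
    (k := j - i) (ρ := fun k => ρ (i + k)) (σ := fun k => w (i + k))
    ⟨by omega, by simp [hij.le, hi', hj'], fun k _ => ⟨h.sameSCC hq hi' (by omega), h.2 _⟩⟩
  exact ⟨i + k, hk, by omega⟩

end BA

/-- König's lemma for a sequence of nonempty layers of a finite type. -/
theorem exists_seq_of_layers {Q : Type*} [Finite Q] (L : ℕ → Set Q) (R : ℕ → Q → Q → Prop)
    (hne : ∀ i, (L i).Nonempty) (hpred : ∀ i, ∀ q ∈ L (i + 1), ∃ p ∈ L i, R i p q) :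
    ∃ r : ℕ → Q, ∀ i, r i ∈ L i ∧ R i (r i) (r (i + 1)) := by
  have hpath : ∀ k, ∀ q ∈ L k, ∃ f : ℕ → Q, f k = q ∧ (∀ i ≤ k, f i ∈ L i) ∧
      ∀ i < k, R i (f i) (f (i + 1)) := by
    intro k
    induction k with
    | zero => exact fun q hq => ⟨fun _ => q, rfl, by simpa using hq, by simp⟩
    | succ k ih =>
      intro q hq
      obtain ⟨p, hp, hR⟩ := hpred k q hq
      obtain ⟨f, hfk, hfL, hfR⟩ := ih p hp
      refine ⟨Function.update f (k + 1) q, by simp, fun i hi => ?_, fun i hi => ?_⟩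
      · rcases hi.eq_or_lt with rfl | hi
        · simpa using hq
        · simpa [Function.update_of_ne hi.ne] using hfL i (by omega)
      · rcases (Nat.lt_succ_iff.mp hi).eq_or_lt with rfl | hi'
        · simpa [hfk] using hR
        · simpa [Function.update_of_ne hi.ne, hi'.ne] using hfR i hi'
  have hpath' : ∀ k, ∃ f : ℕ → Q, (∀ i ≤ k, f i ∈ L i) ∧ ∀ i < k, R i (f i) (f (i + 1)) :=
    fun k => let ⟨q, hq⟩ := hne k; let ⟨f, _, hf⟩ := hpath k q hq; ⟨f, hf⟩
  choose f hfL hfR using hpath'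
  have hlim : ∀ i, ∃ q, ∀ᶠ k in (Filter.hyperfilter ℕ : Filter ℕ), f k i = q := by
    intro i
    obtain ⟨q, hq⟩ := Ultrafilter.eq_pure_of_finite ((Filter.hyperfilter ℕ).map fun k => f k i)
    refine ⟨q, ?_⟩
    have : {q} ∈ (Filter.hyperfilter ℕ).map fun k => f k i := by rw [hq]; exact rfl
    exact this
  choose r hr using hlim
  refine ⟨r, fun i => ?_⟩
  have hgt : ∀ᶠ k in (Filter.hyperfilter ℕ : Filter ℕ), i < k :=
    Nat.hyperfilter_le_atTop (Filter.eventually_gt_atTop i)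
  obtain ⟨k, h1, h2, hk⟩ := ((hr i).and ((hr (i + 1)).and hgt)).exists
  exact ⟨h1 ▸ hfL k i hk.le, h1 ▸ h2 ▸ hfR k i hk⟩

theorem TELA.mem_infCols_iff {Q A γ : Type*} [Finite Q] [Finite A] [Finite γ]
    {w : ℕ → A} {ρ : ℕ → Q} {κ : ℕ → Set γ} {c : γ} :
    c ∈ TELA.infCols w ρ κ ↔ {i | c ∈ κ i}.Infinite := by
  constructor
  · rintro ⟨t, ht, hc⟩
    exact ht.mono fun i hi => by
      rw [← (show (ρ i, w i, κ i, ρ (i + 1)) = t from hi)] at hc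
      exact hc
  · intro h
    obtain ⟨t, ht⟩ := BA.exists_infinite_fiber_of_infinite h
      fun i => (ρ i, w i, κ i, ρ (i + 1))
    refine ⟨t, ht.mono fun _ hi => hi.2, ?_⟩
    obtain ⟨i, hi, rfl⟩ := ht.nonempty
    exact hi

section Breakpoint

variable {Q A : Type} (M : BA Q A) (P : Set Q)

/-- The successor of a macrostate of `iwcTELA`. -/
def iwcNext (x : Set Q × Set Q × Set Q) (a : A) : Set Q × Set Q × Set Q :=
  (M.deltaSet x.1 a, M.deltaSet x.1 a ∩ P,
    if M.deltaSet x.2.2 a ∩ (M.deltaSet x.1 a ∩ P) = ∅ then M.deltaSet x.1 a ∩ P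
    else M.deltaSet x.2.2 a ∩ (M.deltaSet x.1 a ∩ P))

/-- The sequence of macrostates of `iwcTELA` on a word. -/
def iwcSeq (w : ℕ → A) : ℕ → Set Q × Set Q × Set Q
  | 0 => (M.init, M.init ∩ P, M.init ∩ P)
  | i + 1 => iwcNext M P (iwcSeq w i) (w i)

/-- The step at position `i` empties the breakpoint set. -/
def IwcBreak (w : ℕ → A) (i : ℕ) : Prop :=
  M.deltaSet (iwcSeq M P w i).2.2 (w i) ∩ (M.deltaSet (iwcSeq M P w i).1 (w i) ∩ P) = ∅

variable {M P}

theorem iwcTELA_isRun_iff {w : ℕ → A} {ρ : ℕ → Set Q × Set Q × Set Q} {κ : ℕ → Set Unit} :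
    (iwcTELA M P).IsRun w ρ κ ↔
      ρ = iwcSeq M P w ∧ κ = fun i => if IwcBreak M P w i then {()} else ∅ := by
  constructor
  · rintro ⟨h0, hs⟩
    have hstep : ∀ i, ρ (i + 1) = iwcNext M P (ρ i) (w i) ∧
        κ i = if M.deltaSet (ρ i).2.2 (w i) ∩ (M.deltaSet (ρ i).1 (w i) ∩ P) = ∅
          then {()} else ∅ := by
      intro i
      obtain ⟨H, C, B, a, h⟩ := hs i
      simp only [Prod.ext_iff] at h
      obtain ⟨⟨hH, hC, hB⟩, ha, hκ, h1, h2, h3⟩ := h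
      simp only [iwcNext, Prod.ext_iff, hH, hB, ha]
      exact ⟨⟨h1, h2, h3⟩, hκ⟩
    have hρ : ρ = iwcSeq M P w := by
      funext i
      induction i with
      | zero => exact h0
      | succ i ih => rw [(hstep i).1, ih]; rfl
    subst hρ
    exact ⟨rfl, funext fun i => (hstep i).2⟩
  · rintro ⟨rfl, rfl⟩
    exact ⟨rfl, fun i => ⟨_, _, _, _, rfl⟩⟩

theorem mem_iwcTELA_lang_iff [Finite Q] [Finite A] {w : ℕ → A} :
    w ∈ (iwcTELA M P).lang ↔ {i | IwcBreak M P w i}.Infinite := by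
  have hcol : {i | () ∈ (if IwcBreak M P w i then ({()} : Set Unit) else ∅)} =
      {i | IwcBreak M P w i} := by
    ext i
    by_cases h : IwcBreak M P w i <;> simp [h]
  constructor
  · rintro ⟨ρ, κ, hrun, hacc⟩
    obtain ⟨rfl, rfl⟩ := iwcTELA_isRun_iff.mp hrun
    exact hcol ▸ TELA.mem_infCols_iff.mp hacc
  · intro h
    exact ⟨_, _, iwcTELA_isRun_iff.mpr ⟨rfl, rfl⟩, TELA.mem_infCols_iff.mpr (hcol ▸ h)⟩

theorem iwcSeq_subset (w : ℕ → A) (i : ℕ) :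
    (iwcSeq M P w i).2.2 ⊆ (iwcSeq M P w i).1 ∩ P := by
  cases i with
  | zero => exact subset_rfl
  | succ i =>
    simp only [iwcSeq, iwcNext]
    split_ifs
    · exact subset_rfl
    · exact Set.inter_subset_right

theorem BA.IsRun.mem_iwcSeq {w : ℕ → A} {r : ℕ → Q} (h : M.IsRun w r) (i : ℕ) :
    r i ∈ (iwcSeq M P w i).1 := by
  induction i with
  | zero => exact h.1
  | succ i ih => exact ⟨r i, ih, h.2 i⟩

theorem BA.IsRun.finite_iwcBreak {w : ℕ → A} {r : ℕ → Q} (h : M.IsRun w r) {n : ℕ}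
    (hn : ∀ i ≥ n, r i ∈ P) : {i | IwcBreak M P w i}.Finite := by
  by_contra hinf
  obtain ⟨i, hi, hni⟩ := Set.Infinite.exists_gt hinf n
  obtain ⟨j, hj, hij⟩ := Set.Infinite.exists_gt hinf i
  have hstar : ∀ k ≥ n, r k ∈ (iwcSeq M P w k).2.2 →
      r (k + 1) ∈ M.deltaSet (iwcSeq M P w k).2.2 (w k) ∩
        (M.deltaSet (iwcSeq M P w k).1 (w k) ∩ P) := fun k hk hr =>
    ⟨⟨r k, hr, h.2 k⟩, ⟨r k, h.mem_iwcSeq k, h.2 k⟩, hn _ (by omega)⟩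
  have hB : ∀ k ≥ i + 1, r k ∈ (iwcSeq M P w k).2.2 := by
    intro k hk
    induction k, hk using Nat.le_induction with
    | base =>
      simp only [iwcSeq, iwcNext]
      rw [if_pos (show _ = ∅ from hi)]
      exact ⟨h.mem_iwcSeq (i + 1), hn _ (by omega)⟩
    | succ k hk ih =>
      have := hstar k (by omega) ih
      simp only [iwcSeq, iwcNext]
      rw [if_neg (Set.nonempty_iff_ne_empty.mp ⟨_, this⟩)]
      exact this
  have hmem := hstar j (by omega) (hB j hij)
  rw [show _ = ∅ from hj] at hmem
  exact hmem

theorem exists_isRun_of_finite_iwcBreak [Finite Q] {w : ℕ → A}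
    (hfin : {i | IwcBreak M P w i}.Finite) :
    ∃ r n, M.IsRun w r ∧ ∀ i ≥ n, r i ∈ P := by
  obtain ⟨n, hn⟩ := hfin.bddAbove
  have hnb : ∀ i > n, ¬ IwcBreak M P w i := fun i hi hb => by
    have : i ≤ n := hn hb
    omega
  have hB : ∀ i > n, (iwcSeq M P w (i + 1)).2.2 =
      M.deltaSet (iwcSeq M P w i).2.2 (w i) ∩
        (M.deltaSet (iwcSeq M P w i).1 (w i) ∩ P) := fun i hi => by
    conv_lhs => simp only [iwcSeq, iwcNext]
    exact if_neg (hnb i hi)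
  let L : ℕ → Set Q := fun i =>
    if i ≤ n + 1 then (iwcSeq M P w i).1 else (iwcSeq M P w i).2.2
  have hpred : ∀ i, ∀ q ∈ L (i + 1), ∃ p ∈ L i, (p, w i, q) ∈ M.delta := by
    intro i q hq
    simp only [L] at hq ⊢
    rcases lt_trichotomy i (n + 1) with hi | hi | hi
    · rw [if_pos (by omega)] at hq ⊢
      exact hq
    · rw [if_neg (by omega)] at hq
      rw [if_pos (by omega)]
      exact (iwcSeq_subset w (i + 1) hq).1
    · rw [if_neg (by omega)] at hq ⊢
      rw [hB i (by omega)] at hq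
      exact hq.1
  have hlate : ∀ i > n + 1, (L i).Nonempty := by
    rintro (_ | i) hi
    · omega
    · simp only [L]
      rw [if_neg (by omega), hB i (by omega)]
      exact Set.nonempty_iff_ne_empty.mpr (hnb i (by omega))
  have hdown : ∀ k i, (L (i + k)).Nonempty → (L i).Nonempty := by
    intro k
    induction k with
    | zero => exact fun i h => h
    | succ k ih =>
      rintro i ⟨q, hq⟩
      obtain ⟨p, hp, -⟩ := hpred (i + k) q hq
      exact ih i ⟨p, hp⟩
  obtain ⟨r, hr⟩ := exists_seq_of_layers L (fun i p q => (p, w i, q) ∈ M.delta)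
    (fun i => hdown (n + 2) i (hlate _ (by omega))) hpred
  refine ⟨r, n + 2, ⟨?_, fun i => (hr i).2⟩, fun i hi => ?_⟩
  · simpa [L, iwcSeq] using (hr 0).1
  · have := (hr i).1
    simp only [L] at this
    rw [if_neg (by omega)] at this
    exact (iwcSeq_subset w i this).2

end Breakpoint

theorem statement3 {Q A : Type} [Fintype Q] [Fintype A] [Nonempty A]
    (M : BA Q A) (hcompl : M.Complete) (P : Set Q)
    (hblock : M.IsPartitionBlock P)
    (hweak : ∀ C, M.IsSCC C → C ⊆ P → M.IsAccSCC C ∧ M.InherentlyWeak C)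
    (hF : ∀ p a q, (p, a, q) ∈ M.F → p ∈ P ∧ q ∈ P) :
    (iwcTELA M P).lang = (M.lang)ᶜ := by
  ext w
  rw [mem_iwcTELA_lang_iff, Set.mem_compl_iff]
  constructor
  · rintro hinf ⟨r, hr⟩
    obtain ⟨n, hn⟩ := hr.eventually_mem hblock hF
    exact hinf (hr.1.finite_iwcBreak hn)
  · intro hw hfin
    obtain ⟨r, n, hr, hn⟩ := exists_isRun_of_finite_iwcBreak hfin
    exact hw ⟨r, hr.accRun_of_eventually_mem hblock hweak hn⟩
end
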